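/- arXiv:1412.8558 — 7 statements merged into one kernel-verified Lean document; each statement's English description precedes it below -/
import Mathlib

section
/- Let L be a finite lattice and let p and q be prime intervals of L. Then con(p) collapses q if and only if p is prime-projective to q, that is, if and only if there exists a finite sequence of prime intervals p = u_0, u_1, …, u_n = q (n ≥ 0) such that for each i = 1, …, n, the interval u_{i-1} is prime-perspective to u_i (i.e., u_{i-1} ⇘ u_i or u_{i-1} ⇗ u_i). -/
/-- A congruence of a lattice `L`: an equivalence relation compatible
with joins and meets. -/
def IsLatticeCongruence {L : Type*} [Lattice L] (θ : L → L → Prop) : Prop :=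
  Equivalence θ ∧
    ∀ a b c d : L, θ a b → θ c d → θ (a ⊔ c) (b ⊔ d) ∧ θ (a ⊓ c) (b ⊓ d)

/-- `p` is prime-perspective down to `q` (intervals given as pairs):
`1_p = 0_p ⊔ 1_q` and `0_p ⊓ 1_q ≤ 0_q`. -/
def PPerspDown {L : Type*} [Lattice L] (p q : L × L) : Prop :=
  p.2 = p.1 ⊔ q.2 ∧ p.1 ⊓ q.2 ≤ q.1

/-- `p` is prime-perspective up to `q`:
`0_p = 1_p ⊓ 0_q` and `1_q ≤ 1_p ⊔ 0_q`. -/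
def PPerspUp {L : Type*} [Lattice L] (p q : L × L) : Prop :=
  p.1 = p.2 ⊓ q.1 ∧ q.2 ≤ p.2 ⊔ q.1

/-- `p` is prime-perspective to `q`. -/
def PPersp {L : Type*} [Lattice L] (p q : L × L) : Prop :=
  PPerspDown p q ∨ PPerspUp p q

section PrimeProjectivity

variable {L : Type*} [Lattice L]

/-- A relation on prime intervals which propagates along prime-perspectivities. -/
structure PPerspClosed (Q : L → L → Prop) : Prop where
  down : ∀ {a b c d : L}, a ⋖ b → c ⋖ d → Q a b → b = a ⊔ d → a ⊓ d ≤ c → Q c d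
  up : ∀ {a b c d : L}, a ⋖ b → c ⋖ d → Q a b → a = b ⊓ c → d ≤ b ⊔ c → Q c d

/-- Every prime interval contained in `[a, b]` satisfies `Q`. -/
def AllPrimes (Q : L → L → Prop) (a b : L) : Prop :=
  ∀ x y : L, a ≤ x → x ⋖ y → y ≤ b → Q x y

theorem AllPrimes.mono {Q : L → L → Prop} {a b c d : L} (h : AllPrimes Q a b)
    (hac : a ≤ c) (hdb : d ≤ b) : AllPrimes Q c d :=
  fun x y hx hxy hy => h x y (hac.trans hx) hxy (hy.trans hdb)

theorem AllPrimes.dual {Q : L → L → Prop} {a b : L} (h : AllPrimes Q a b) :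
    AllPrimes (L := Lᵒᵈ) (fun x y => Q (OrderDual.ofDual y) (OrderDual.ofDual x))
      (OrderDual.toDual b) (OrderDual.toDual a) :=
  fun x y hx hxy hy => h (OrderDual.ofDual y) (OrderDual.ofDual x) hy hxy.ofDual hx

theorem PPerspClosed.dual {Q : L → L → Prop} (hQ : PPerspClosed Q) :
    PPerspClosed (L := Lᵒᵈ)
      (fun x y => Q (OrderDual.ofDual y) (OrderDual.ofDual x)) where
  down hab hcd h h₁ h₂ := hQ.up hab.ofDual hcd.ofDual h h₁ h₂
  up hab hcd h h₁ h₂ := hQ.down hab.ofDual hcd.ofDual h h₁ h₂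

theorem CovBy.inf_eq_of_not_le {x y w : L} (h : x ⋖ y) (hxw : x ≤ w) (hyw : ¬ y ≤ w) :
    y ⊓ w = x :=
  (h.eq_or_eq (le_inf h.le hxw) inf_le_left).resolve_right fun e => hyw (inf_eq_left.mp e)

section Finite

variable [Finite L] {Q : L → L → Prop}

/-- If `y ≰ w`, the prime interval `x ⋖ y` is reached downwards from a prime interval
at the top of `[w, y ⊔ w]`. -/
theorem PPerspClosed.exists_covBy_sup (hQ : PPerspClosed Q) {x y w : L} (h : x ⋖ y)
    (hxw : x ≤ w) (hyw : ¬ y ≤ w) :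
    ∃ v, w ≤ v ∧ v ⋖ y ⊔ w ∧ ¬ y ≤ v ∧ (Q v (y ⊔ w) → Q x y) := by
  obtain ⟨v, hwv, hv⟩ := exists_le_covBy_of_lt (right_lt_sup.mpr hyw)
  have hyv : ¬ y ≤ v := fun hy => hv.lt.not_ge (sup_le hy hwv)
  refine ⟨v, hwv, hv, hyv, fun hq => hQ.down hv h hq ?_ ?_⟩
  · exact le_antisymm (sup_le le_sup_right (hwv.trans le_sup_left))
      (sup_le hv.le le_sup_left)
  · rw [inf_comm, h.inf_eq_of_not_le (hxw.trans hwv) hyv]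

theorem AllPrimes.sup_right (hQ : PPerspClosed Q) {a b : L} (h : AllPrimes Q a b)
    (hab : a ≤ b) (c : L) : AllPrimes Q (a ⊔ c) (b ⊔ c) := by
  intro x y hx hxy hy
  obtain ⟨hax, hcx⟩ := sup_le_iff.mp hx
  obtain ⟨z, hz⟩ := (Set.toFinite {z | a ≤ z ∧ z ≤ b ∧ ¬ y ≤ x ⊔ z}).exists_maximal
    ⟨a, le_rfl, hab, by rw [sup_eq_left.mpr hax]; exact hxy.lt.not_ge⟩
  obtain ⟨haz, hzb, hyz⟩ := hz.prop
  have hne : z ≠ b := by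
    rintro rfl
    exact hyz (hy.trans (sup_le le_sup_right (hcx.trans le_sup_left)))
  obtain ⟨t, hzt, htb⟩ := exists_covBy_le_of_lt (hzb.lt_of_ne hne)
  have hyt : y ≤ x ⊔ t := by
    by_contra hyt
    exact hz.not_gt ⟨haz.trans hzt.le, htb, hyt⟩ hzt.lt
  obtain ⟨v, hwv, hv, hyv, hq⟩ := hQ.exists_covBy_sup hxy le_sup_left hyz
  have hxv : x ≤ v := le_sup_left.trans hwv
  have hzv : z ≤ v := le_sup_right.trans hwv
  have htv : ¬ t ≤ v := fun ht => hyv (hyt.trans (sup_le hxv ht))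
  refine hq (hQ.up hzt hv (h z t haz hzt htb) (hzt.inf_eq_of_not_le hzv htv).symm ?_)
  exact sup_le (hyt.trans (sup_le (hxv.trans le_sup_right) le_sup_left))
    (hwv.trans le_sup_right)

theorem AllPrimes.inf_right (hQ : PPerspClosed Q) {a b : L} (h : AllPrimes Q a b)
    (hab : a ≤ b) (c : L) : AllPrimes Q (a ⊓ c) (b ⊓ c) :=
  (AllPrimes.sup_right hQ.dual h.dual (OrderDual.toDual_le_toDual.mpr hab)
    (OrderDual.toDual c)).dual

theorem AllPrimes.trans (hQ : PPerspClosed Q) {a b c : L} (h₁ : AllPrimes Q a b)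
    (h₂ : AllPrimes Q b c) (hab : a ≤ b) (hbc : b ≤ c) : AllPrimes Q a c := by
  intro x y hx hxy hy
  by_cases hyb : y ≤ x ⊔ b
  · exact h₁.sup_right hQ hab x x y (sup_le hx le_rfl) hxy (by rwa [sup_comm])
  · obtain ⟨v, hwv, hv, -, hq⟩ := hQ.exists_covBy_sup hxy le_sup_left hyb
    exact hq (h₂ _ _ (le_sup_right.trans hwv) hv
      (sup_le hy (sup_le (hxy.le.trans hy) hbc)))

theorem PPerspClosed.isLatticeCongruence (hQ : PPerspClosed Q) :
    IsLatticeCongruence fun a b : L => AllPrimes Q (a ⊓ b) (a ⊔ b) := by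
  have htrans : ∀ {a b c : L}, AllPrimes Q (a ⊓ b) (a ⊔ b) → AllPrimes Q (b ⊓ c) (b ⊔ c) →
      AllPrimes Q (a ⊓ c) (a ⊔ c) := by
    intro a b c h₁ h₂
    have hlow : AllPrimes Q (b ⊓ c ⊓ (a ⊓ b)) (a ⊓ b) :=
      (h₂.inf_right hQ inf_le_sup (a ⊓ b)).mono le_rfl
        (le_inf (inf_le_right.trans le_sup_left) le_rfl)
    have hhigh : AllPrimes Q (a ⊔ b) (b ⊔ c ⊔ (a ⊔ b)) :=
      (h₂.sup_right hQ inf_le_sup (a ⊔ b)).mono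
        (sup_le (inf_le_left.trans le_sup_right) le_rfl) le_rfl
    refine ((hlow.trans hQ h₁ inf_le_right inf_le_sup).trans hQ hhigh
      (inf_le_right.trans inf_le_sup) le_sup_right).mono ?_ ?_
    · exact le_inf (inf_le_right.trans inf_le_left) (inf_le_left.trans inf_le_right)
    · exact sup_le (le_sup_left.trans le_sup_right) (le_sup_right.trans le_sup_left)
  have hsymm : ∀ {a b : L}, AllPrimes Q (a ⊓ b) (a ⊔ b) → AllPrimes Q (b ⊓ a) (b ⊔ a) := by
    intro a b h
    rwa [inf_comm, sup_comm]
  have hsup : ∀ {a b : L} (c : L), AllPrimes Q (a ⊓ b) (a ⊔ b) →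
      AllPrimes Q ((a ⊔ c) ⊓ (b ⊔ c)) (a ⊔ c ⊔ (b ⊔ c)) := fun c h =>
    (h.sup_right hQ inf_le_sup c).mono
      (le_inf (sup_le_sup_right inf_le_left c) (sup_le_sup_right inf_le_right c))
      (sup_le (sup_le_sup_right le_sup_left c) (sup_le_sup_right le_sup_right c))
  have hinf : ∀ {a b : L} (c : L), AllPrimes Q (a ⊓ b) (a ⊔ b) →
      AllPrimes Q (a ⊓ c ⊓ (b ⊓ c)) (a ⊓ c ⊔ b ⊓ c) := fun c h =>
    (h.inf_right hQ inf_le_sup c).mono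
      (le_inf (inf_le_inf_right c inf_le_left) (inf_le_inf_right c inf_le_right))
      (sup_le (inf_le_inf_right c le_sup_left) (inf_le_inf_right c le_sup_right))
  refine ⟨⟨fun a x y hx hxy hy => ?_, hsymm, htrans⟩, fun a b c d hab hcd => ⟨?_, ?_⟩⟩
  · rw [inf_idem] at hx
    rw [sup_idem] at hy
    exact absurd (hy.trans hx) hxy.lt.not_ge
  · have h := hsup b hcd
    rw [sup_comm c b, sup_comm d b] at h
    exact htrans (hsup c hab) h
  · have h := hinf b hcd
    rw [inf_comm c b, inf_comm d b] at h
    exact htrans (hinf c hab) h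

end Finite

theorem IsLatticeCongruence.of_pPersp {θ : L → L → Prop} (hθ : IsLatticeCongruence θ)
    {p q : L × L} (hq : q.1 ≤ q.2) (h : PPersp p q) (hpq : θ p.1 p.2) :
    θ q.1 q.2 := by
  obtain ⟨heq, hcomp⟩ := hθ
  rcases h with ⟨h₁, h₂⟩ | ⟨h₁, h₂⟩
  · have hm := (hcomp _ _ _ _ hpq (heq.refl q.2)).2
    have hj := (hcomp _ _ _ _ hm (heq.refl q.1)).1
    have hle : q.2 ≤ p.2 := h₁ ▸ le_sup_right
    rwa [sup_eq_right.mpr h₂, inf_eq_right.mpr hle, sup_eq_left.mpr hq] at hj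
  · have hj := (hcomp _ _ _ _ hpq (heq.refl q.1)).1
    have hm := (hcomp _ _ _ _ hj (heq.refl q.2)).2
    have hle : p.1 ≤ q.1 := h₁ ▸ inf_le_right
    rwa [inf_eq_right.mpr h₂, sup_eq_right.mpr hle, inf_eq_left.mpr hq] at hm

/-- `p` is prime-projective to `q`. -/
def PProj (p q : L × L) : Prop :=
  ∃ (n : ℕ) (u : ℕ → L × L), u 0 = p ∧ u n = q ∧
    (∀ i ≤ n, (u i).1 ⋖ (u i).2) ∧ (∀ i < n, PPersp (u i) (u (i + 1)))

theorem PProj.tail {p q r : L × L} (h : PProj p q) (hqr : PPersp q r) (hr : r.1 ⋖ r.2) :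
    PProj p r := by
  obtain ⟨n, u, h0, rfl, hcov, hstep⟩ := h
  refine ⟨n + 1, fun i => if i ≤ n then u i else r, by simpa using h0, by simp, ?_, ?_⟩
  · intro i _
    by_cases hi : i ≤ n
    · simpa [hi] using hcov i hi
    · simpa [hi] using hr
  · intro i hi
    rcases (Nat.lt_succ_iff.mp hi).lt_or_eq with hi | rfl
    · simpa [hi.le, Nat.succ_le_of_lt hi] using hstep i hi
    · simpa using hqr

theorem pPerspClosed_pProj (p : L × L) : PPerspClosed fun x y => PProj p (x, y) where
  down _ hcd h h₁ h₂ := h.tail (.inl ⟨h₁, h₂⟩) hcd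
  up _ hcd h h₁ h₂ := h.tail (.inr ⟨h₁, h₂⟩) hcd

theorem IsLatticeCongruence.of_pProj {θ : L → L → Prop} (hθ : IsLatticeCongruence θ)
    {p q : L × L} (h : PProj p q) (hp : θ p.1 p.2) : θ q.1 q.2 := by
  obtain ⟨n, u, rfl, rfl, hcov, hstep⟩ := h
  have key : ∀ i ≤ n, θ (u i).1 (u i).2 := by
    intro i
    induction i with
    | zero => exact fun _ => hp
    | succ i ih =>
      exact fun hi => hθ.of_pPersp (hcov _ hi).le
        (hstep i hi) (ih (Nat.le_of_succ_le hi))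
  exact key n le_rfl

end PrimeProjectivity

/-- Prime-projectivity Lemma: in a finite lattice, `con(p)` collapses the
prime interval `q` iff `p` is prime-projective to `q`, i.e. there is a finite
sequence of prime intervals from `p` to `q` with consecutive members
prime-perspective. (`con(p)` collapses `q` is expressed by saying that every
congruence collapsing `p` collapses `q`, since `con(p)` is the smallest
congruence collapsing `p`.) -/
theorem prime_projectivity_lemma {L : Type*} [Lattice L] [Finite L]
    (p0 p1 q0 q1 : L) (hp : p0 ⋖ p1) (hq : q0 ⋖ q1) :
    (∀ θ : L → L → Prop, IsLatticeCongruence θ → θ p0 p1 → θ q0 q1) ↔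
      ∃ (n : ℕ) (u : ℕ → L × L),
        u 0 = (p0, p1) ∧ u n = (q0, q1) ∧
        (∀ i ≤ n, (u i).1 ⋖ (u i).2) ∧
        (∀ i < n, PPersp (u i) (u (i + 1))) := by
  constructor
  · intro h
    have hcon := (pPerspClosed_pProj (p0, p1)).isLatticeCongruence
    refine h _ hcon ?_ q0 q1 inf_le_left hq le_sup_right
    intro x y hx hxy hy
    rw [inf_eq_left.mpr hp.le] at hx
    rw [sup_eq_right.mpr hp.le] at hy
    have hxp : x = p0 :=
      (hp.eq_or_eq hx (hxy.le.trans hy)).resolve_right (hxy.lt.trans_le hy).ne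
    have hyp : y = p1 :=
      (hp.eq_or_eq (hx.trans hxy.le) hy).resolve_left (hx.trans_lt hxy.lt).ne'
    subst hxp hyp
    exact ⟨0, fun _ => (x, y), rfl, rfl, fun _ _ => hxy,
      fun _ hi => absurd hi (Nat.not_lt_zero _)⟩
  · intro h θ hθ hpθ
    exact hθ.of_pProj (p := (p0, p1)) (q := (q0, q1)) h hpθ
end

section
/- Let L be a finite lattice in which every element has at most two covers. If elements u, v, w of L are pairwise disjoint over an element a, that is, a = u ∧ v = v ∧ w = w ∧ u, then two of the elements u, v, w are comparable. -/
/-- An element that lies below both `u` and `v` does not cover `u ⊓ v`. -/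
theorem CovBy.false_of_le_of_le {L : Type*} [Lattice L] {a u v p : L} (h : a ⋖ p)
    (huv : a = u ⊓ v) (hu : p ≤ u) (hv : p ≤ v) : False :=
  h.lt.not_ge (huv ▸ le_inf hu hv)

/-- In a finite lattice in which every element has at most two covers,
if `u`, `v`, `w` are pairwise disjoint over `a`
(`a = u ⊓ v = v ⊓ w = w ⊓ u`), then two of `u`, `v`, `w` are comparable. -/
theorem two_comparable_of_pairwise_disjoint_over {L : Type*} [Lattice L] [Finite L]
    (htwo : ∀ x a b c : L, x ⋖ a → x ⋖ b → x ⋖ c → a = b ∨ a = c ∨ b = c)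
    (a u v w : L)
    (huv : a = u ⊓ v) (hvw : a = v ⊓ w) (hwu : a = w ⊓ u) :
    u ≤ v ∨ v ≤ u ∨ v ≤ w ∨ w ≤ v ∨ u ≤ w ∨ w ≤ u := by
  by_contra! h
  obtain ⟨hu, -, hv, -, -, hw⟩ := h
  obtain ⟨p, hap, hpu⟩ := exists_covBy_le_of_lt (huv ▸ inf_lt_left.2 hu : a < u)
  obtain ⟨q, haq, hqv⟩ := exists_covBy_le_of_lt (hvw ▸ inf_lt_left.2 hv : a < v)
  obtain ⟨r, har, hrw⟩ := exists_covBy_le_of_lt (hwu ▸ inf_lt_left.2 hw : a < w)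
  obtain rfl | rfl | rfl := htwo a p q r hap haq har
  · exact hap.false_of_le_of_le huv hpu hqv
  · exact hap.false_of_le_of_le hwu hrw hpu
  · exact haq.false_of_le_of_le hvw hqv hrw
end

section
/- Let L be a finite semimodular lattice in which every element has at most two covers. Let o, u, i, v, w ∈ L form an N5 sublattice: o < u < i, o < v < w < i, u ∧ v = u ∧ w = o, u ∨ v = u ∨ w = i, and assume v ⋖ w (w covers v). If x ∈ L satisfies u ≤ x ⋖ i (i covers x), then x ∧ w < v. -/
/-- In a semimodular lattice whose elements have at most two covers, if `o = u ⊓ w < u`, then any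
two elements of the interval `[o, w]` are comparable: every `m` in this interval has a cover
`m ⊔ a` outside it, where `o ⋖ a ≤ u`, hence at most one cover inside it. -/
theorem le_or_le_of_inf_le_of_le {L : Type*} [Lattice L] [Finite L]
    (hsm : ∀ a b : L, a ⊓ b ⋖ b → a ⋖ a ⊔ b)
    (htwo : ∀ x a b c : L, x ⋖ a → x ⋖ b → x ⋖ c → a = b ∨ a = c ∨ b = c)
    {u w y z : L} (hu : u ⊓ w < u) (hoy : u ⊓ w ≤ y) (hyw : y ≤ w)
    (hoz : u ⊓ w ≤ z) (hzw : z ≤ w) : y ≤ z ∨ z ≤ y := by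
  by_contra! h
  obtain ⟨hyz, hzy⟩ := h
  obtain ⟨a, hoa, hau⟩ := exists_covBy_le_of_lt hu
  obtain ⟨c, hmc, hcy⟩ := exists_covBy_le_of_lt (inf_lt_left.2 hyz)
  obtain ⟨d, hmd, hdz⟩ := exists_covBy_le_of_lt (inf_lt_right.2 hzy)
  have haw : ¬ a ≤ w := fun haw => hoa.lt.not_ge (le_inf hau haw)
  have hma : (y ⊓ z) ⊓ a = u ⊓ w :=
    le_antisymm (le_inf (inf_le_right.trans hau) (inf_le_left.trans (inf_le_left.trans hyw)))
      (le_inf (le_inf hoy hoz) hoa.le)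
  have hcov : y ⊓ z ⋖ y ⊓ z ⊔ a := hsm _ _ (by rwa [hma])
  rcases htwo _ _ _ _ hmc hmd hcov with hcd | hca | hda
  · exact hmc.lt.not_ge (le_inf hcy (hcd ▸ hdz))
  · exact haw (le_sup_right.trans (hca.ge.trans (hcy.trans hyw)))
  · exact haw (le_sup_right.trans (hda.ge.trans (hdz.trans hzw)))

/-- Let `L` be a finite semimodular lattice in which every element has at
most two covers. If `{o, u, i, v, w}` is an `N₅` sublattice with
`o < u < i`, `o < v < w < i`, `u ⊓ v = u ⊓ w = o`, `u ⊔ v = u ⊔ w = i`,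
`v ⋖ w`, and `u ≤ x ⋖ i`, then `x ⊓ w < v`. -/
theorem newlemma {L : Type*} [Lattice L] [Finite L]
    (hsm : ∀ a b : L, a ⊓ b ⋖ b → a ⋖ a ⊔ b)
    (htwo : ∀ x a b c : L, x ⋖ a → x ⋖ b → x ⋖ c → a = b ∨ a = c ∨ b = c)
    (o u i v w x : L)
    (hou : o < u) (hui : u < i) (hov : o < v) (hvw : v < w) (hwi : w < i)
    (huv : u ⊓ v = o) (huw : u ⊓ w = o)
    (hjv : u ⊔ v = i) (hjw : u ⊔ w = i)
    (hcov : v ⋖ w)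
    (hux : u ≤ x) (hxi : x ⋖ i) :
    x ⊓ w < v := by
  have hvx : ¬ v ≤ x := fun h => hxi.lt.not_ge (hjv ▸ sup_le hux h)
  have hle : x ⊓ w ≤ v := by
    rcases le_or_le_of_inf_le_of_le hsm htwo (huw ▸ hou) (inf_le_inf_right w hux) inf_le_right
      (huw ▸ hov.le) hvw.le with h | h
    · exact h
    · exact absurd (h.trans inf_le_left) hvx
  exact hle.lt_of_ne fun h => hvx (h ▸ inf_le_left)
end

section
/- Let L be a semimodular lattice and let p and q be prime intervals of L. If p is prime-perspective up to q (that is, 0_p = 1_p ∧ 0_q and 1_q ≤ 1_p ∨ 0_q), then p is up-perspective to q (that is, 1_p ∧ 0_q = 0_p and 1_p ∨ 0_q = 1_q). -/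
/-- In a semimodular lattice, if the prime interval `p` is prime-perspective
up to the prime interval `q` (`0_p = 1_p ⊓ 0_q` and `1_q ≤ 1_p ⊔ 0_q`),
then `p` is up-perspective to `q`
(`1_p ⊓ 0_q = 0_p` and `1_p ⊔ 0_q = 1_q`). -/
theorem up_persp_of_pPerspUp {L : Type*} [Lattice L]
    (hsm : ∀ a b : L, a ⊓ b ⋖ b → a ⋖ a ⊔ b)
    (p0 p1 q0 q1 : L) (hp : p0 ⋖ p1) (hq : q0 ⋖ q1)
    (h1 : p0 = p1 ⊓ q0) (h2 : q1 ≤ p1 ⊔ q0) :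
    p1 ⊓ q0 = p0 ∧ p1 ⊔ q0 = q1 := by
  have hcov : q0 ⋖ p1 ⊔ q0 := by
    rw [sup_comm]
    apply hsm
    rwa [inf_comm, ← h1]
  exact ⟨h1.symm, (h2.eq_of_not_lt (hcov.2 hq.lt)).symm⟩
end

section
/- Let L be a lattice and let p and q be prime intervals of L with p prime-perspective down to q (1_p = 0_p ∨ 1_q and 0_p ∧ 1_q ≤ 0_q), and suppose d := 0_p ∧ 1_q < 0_q. Then the five elements d, 0_q, 1_q, 0_p, 1_p are pairwise distinct and form a sublattice of L isomorphic to N5; explicitly, d < 0_q < 1_q < 1_p, d < 0_p < 1_p, 0_p is incomparable with both 0_q and 1_q, 0_p ∧ 0_q = 0_p ∧ 1_q = d, and 0_p ∨ 0_q = 0_p ∨ 1_q = 1_p. -/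
/-- If `p ⇘ q` (`1_p = 0_p ⊔ 1_q` and `0_p ⊓ 1_q ≤ 0_q`) with
`d := 0_p ⊓ 1_q < 0_q`, then `d, 0_q, 1_q, 0_p, 1_p` form an `N₅`
sublattice: `d < 0_q < 1_q < 1_p`, `d < 0_p < 1_p`, `0_p` is incomparable
with `0_q` and with `1_q`, `0_p ⊓ 0_q = 0_p ⊓ 1_q = d`, and
`0_p ⊔ 0_q = 0_p ⊔ 1_q = 1_p`. (These conditions make the five elements
pairwise distinct.) -/
theorem pPerspDown_generates_N5 {L : Type*} [Lattice L]
    (p0 p1 q0 q1 : L) (hp : p0 ⋖ p1) (hq : q0 ⋖ q1)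
    (hdn1 : p1 = p0 ⊔ q1) (hdn2 : p0 ⊓ q1 ≤ q0)
    (d : L) (hd : d = p0 ⊓ q1) (hlt : d < q0) :
    d < q0 ∧ q0 < q1 ∧ q1 < p1 ∧ d < p0 ∧ p0 < p1 ∧
    (¬ p0 ≤ q0 ∧ ¬ q0 ≤ p0) ∧ (¬ p0 ≤ q1 ∧ ¬ q1 ≤ p0) ∧
    p0 ⊓ q0 = d ∧ p0 ⊓ q1 = d ∧ p0 ⊔ q0 = p1 ∧ p0 ⊔ q1 = p1 := by
  have hq1p1 : q1 ≤ p1 := hdn1 ▸ le_sup_right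
  have hdp0 : d ≤ p0 := hd ▸ inf_le_left
  have hdq1 : d ≤ q1 := hd ▸ inf_le_right
  have hq0p0 : ¬ q0 ≤ p0 := fun h =>
    hlt.not_ge (hd ▸ le_inf h hq.le)
  have hq1p0 : ¬ q1 ≤ p0 := fun h => hq0p0 (hq.le.trans h)
  have hp0q1 : ¬ p0 ≤ q1 := fun h => by
    have hdp : d = p0 := hd.trans (inf_eq_left.mpr h)
    exact hp.2 (hdp ▸ hlt) (hq.lt.trans_le hq1p1)
  have hsup : p0 ⊔ q0 = p1 :=
    (hp.eq_or_eq le_sup_left (sup_le hp.le (hq.le.trans hq1p1))).resolve_left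
      fun h => hq0p0 (sup_eq_left.mp h)
  have hinf : p0 ⊓ q0 = d :=
    le_antisymm (hd ▸ inf_le_inf_left p0 hq.le) (le_inf hdp0 hlt.le)
  exact ⟨hlt, hq.lt, lt_of_le_not_ge hq1p1 fun h => hp0q1 (hp.le.trans h),
    lt_of_le_not_ge hdp0 fun h => hp0q1 (h.trans hdq1), hp.lt,
    ⟨fun h => hp0q1 (h.trans hq.le), hq0p0⟩, ⟨hp0q1, hq1p0⟩,
    hinf, hd.symm, hsup, hdn1.symm⟩
end

section
/- Let L be a lattice and let p and q be prime intervals of L with 1_p = 0_p ∨ 1_q and d := 0_p ∧ 1_q < 0_q. Let c ∈ L satisfy 1_q < c ⋖ 1_p, set a = 0_p ∧ c, and assume a ⋖ c (so [a,c] is a prime interval). Then [a,c] is prime-perspective down to q; more precisely, a ∧ 1_q = d < 0_q and a ∨ 1_q = c (indeed already a ∨ 0_q = c). -/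
/-- Let `p`, `q` be prime intervals with `1_p = 0_p ⊔ 1_q` and
`d := 0_p ⊓ 1_q < 0_q`. Let `1_q < c ⋖ 1_p`, set `a = 0_p ⊓ c`, and assume
`a ⋖ c`. Then `[a, c]` is prime-perspective down to `q`; more precisely,
`a ⊓ 1_q = d < 0_q` and `a ⊔ 1_q = c` (indeed already `a ⊔ 0_q = c`). -/
theorem prime_interval_step {L : Type*} [Lattice L]
    (p0 p1 q0 q1 : L) (hp : p0 ⋖ p1) (hq : q0 ⋖ q1)
    (hjoin : p1 = p0 ⊔ q1)
    (d : L) (hd : d = p0 ⊓ q1) (hlt : d < q0)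
    (c : L) (hqc : q1 < c) (hcp : c ⋖ p1)
    (a : L) (ha : a = p0 ⊓ c) (hac : a ⋖ c) :
    a ⊓ q1 = d ∧ d < q0 ∧ a ⊔ q0 = c ∧ a ⊔ q1 = c := by
  have hq0c : q0 ≤ c := hq.le.trans hqc.le
  have hq0a : ¬q0 ≤ a := fun h =>
    hlt.not_ge (hd ▸ le_inf (h.trans (ha ▸ inf_le_left)) hq.le)
  have hsup : a ⊔ q0 = c :=
    (hac.eq_or_eq le_sup_left (sup_le hac.le hq0c)).resolve_left
      fun h => hq0a (sup_eq_left.mp h)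
  refine ⟨?_, hlt, hsup, ?_⟩
  · rw [ha, hd, inf_assoc, inf_eq_right.mpr hqc.le]
  · exact le_antisymm (sup_le hac.le hqc.le) (hsup ▸ sup_le_sup_left hq.le a)
end

section
/- Let L be a semimodular lattice and let p and q be prime intervals of L. If p is prime-perspective up to q (0_p = 1_p ∧ 0_q and 1_q ≤ 1_p ∨ 0_q), then con(p) = con(q). -/
/-- `latConGen x y a b` holds iff `(a, b)` belongs to the smallest congruence
collapsing the pair `(x, y)`. -/
def latConGen {L : Type*} [Lattice L] (x y a b : L) : Prop :=
  ∀ θ : L → L → Prop, IsLatticeCongruence θ → θ x y → θ a b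

/-- In a semimodular lattice, if the prime interval `p` is prime-perspective
up to the prime interval `q` (`0_p = 1_p ⊓ 0_q` and `1_q ≤ 1_p ⊔ 0_q`),
then `con(p) = con(q)`. -/
theorem con_eq_of_pPerspUp {L : Type*} [Lattice L]
    (hsm : ∀ a b : L, a ⊓ b ⋖ b → a ⋖ a ⊔ b)
    (p0 p1 q0 q1 : L) (hp : p0 ⋖ p1) (hq : q0 ⋖ q1)
    (h1 : p0 = p1 ⊓ q0) (h2 : q1 ≤ p1 ⊔ q0) :
    ∀ a b : L, latConGen p0 p1 a b ↔ latConGen q0 q1 a b := by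
  have hcov : q0 ⋖ q0 ⊔ p1 := hsm q0 p1 (by rwa [inf_comm, ← h1])
  have hq1 : q1 = q0 ⊔ p1 :=
    (hcov.eq_or_eq hq.le (by rwa [sup_comm])).resolve_left hq.lt.ne'
  have hiff : ∀ θ : L → L → Prop, IsLatticeCongruence θ → (θ p0 p1 ↔ θ q0 q1) := by
    intro θ hθ
    constructor
    · intro h
      have := (hθ.2 _ _ _ _ (hθ.1.refl q0) h).1
      rwa [sup_eq_left.2 (h1.trans_le inf_le_right), ← hq1] at this
    · intro h
      have := (hθ.2 _ _ _ _ (hθ.1.refl p1) h).2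
      rwa [← h1, inf_eq_left.2 (le_sup_right.trans hq1.ge)] at this
  exact fun a b => forall₂_congr fun θ hθ => imp_congr_left (hiff θ hθ)
end
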